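/- Let u : ℝⁿ × (0,∞) → ℝ be a nonnegative classical solution (C² in the space variable and C¹ in the time variable on ℝⁿ × (0,∞), continuous up to t = 0) of u_t = Δu + u^p V on ℝⁿ × (0,∞), where V : ℝⁿ × (0,∞) → ℝ is continuous and positive and p > 1. Assume V satisfies the conditions (VOL) with point x₀, constants C₀, R₀ and exponent α > 0. Set q = p/(p−1). Then there exists a constant C > 0 such that for every R ≥ R₀, ∫_{0}^{R²/4} ∫_{B_{R/2}(x₀)} V(x,t) u(x,t)^p dx dt ≤ C R^{2+α−2q}. -/

import Mathlib

open MeasureTheory Real Set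

/-- The Laplacian in the space variables on Euclidean space: the sum of the pure second
directional derivatives along the standard coordinate directions. -/
noncomputable def laplacian {n : ℕ} (f : EuclideanSpace ℝ (Fin n) → ℝ)
    (x : EuclideanSpace ℝ (Fin n)) : ℝ :=
  ∑ i, fderiv ℝ (fun y => fderiv ℝ f y (EuclideanSpace.single i 1)) x (EuclideanSpace.single i 1)

open Filter Topology

lemma second_deriv_nonneg_of_isLocalMin {f : ℝ → ℝ} {a : ℝ} (h : IsLocalMin f a)
    (hc : ContinuousAt f a) : 0 ≤ deriv (deriv f) a := by
  by_contra hneg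
  push Not at hneg
  have hmax := isLocalMax_of_deriv_deriv_neg hneg h.deriv_eq_zero hc
  have hconst : f =ᶠ[𝓝 a] fun _ => f a := by
    filter_upwards [h, hmax] with y h1 h2
    exact le_antisymm h2 h1
  have h3 : deriv f =ᶠ[𝓝 a] fun _ => 0 := by
    filter_upwards [hconst.deriv] with y hy
    simpa using hy
  have := h3.deriv_eq
  simp at this
  linarith

lemma fderiv_apply_contDiff {n : ℕ} {f : EuclideanSpace ℝ (Fin n) → ℝ} (hf : ContDiff ℝ 2 f)
    (e : EuclideanSpace ℝ (Fin n)) : ContDiff ℝ 1 (fun y => fderiv ℝ f y e) :=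
  (hf.fderiv_right (m := 1) (by norm_num)).clm_apply contDiff_const

lemma laplacian_continuous {n : ℕ} {f : EuclideanSpace ℝ (Fin n) → ℝ} (hf : ContDiff ℝ 2 f) :
    Continuous (laplacian f) := by
  unfold laplacian
  refine continuous_finsetSum _ fun i _ => ?_
  exact ((fderiv_apply_contDiff hf _).continuous_fderiv (by norm_num)).clm_apply continuous_const

lemma laplacian_nonneg_of_isLocalMin {n : ℕ} {f : EuclideanSpace ℝ (Fin n) → ℝ}
    (hf : ContDiff ℝ 2 f) {x : EuclideanSpace ℝ (Fin n)} (h : IsLocalMin f x) :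
    0 ≤ laplacian f x := by
  unfold laplacian
  refine Finset.sum_nonneg fun i _ => ?_
  set e : EuclideanSpace ℝ (Fin n) := EuclideanSpace.single i 1
  have hline : ∀ τ : ℝ, HasDerivAt (fun τ : ℝ => x + τ • e) e τ := fun τ => by
    simpa using ((hasDerivAt_id τ).smul_const e).const_add x
  have h1 : ∀ τ : ℝ, HasDerivAt (fun τ : ℝ => f (x + τ • e)) (fderiv ℝ f (x + τ • e) e) τ :=
    fun τ => ((hf.differentiable (by norm_num)) _).hasFDerivAt.comp_hasDerivAt τ (hline τ)
  have h2 : deriv (fun τ : ℝ => f (x + τ • e)) = fun τ => fderiv ℝ f (x + τ • e) e :=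
    funext fun τ => (h1 τ).deriv
  have h3 : HasDerivAt (fun τ : ℝ => fderiv ℝ f (x + τ • e) e)
      (fderiv ℝ (fun y => fderiv ℝ f y e) x e) 0 := by
    have := (((fderiv_apply_contDiff hf e).differentiable (by norm_num)) (x + (0:ℝ) • e)).hasFDerivAt.comp_hasDerivAt
      (0:ℝ) (hline 0)
    simp only [zero_smul, add_zero] at this
    exact this
  have h4 : IsLocalMin (fun τ : ℝ => f (x + τ • e)) 0 := by
    have hc : ContinuousAt (fun τ : ℝ => x + τ • e) 0 := (hline 0).continuousAt
    have h' : IsLocalMin f ((fun τ : ℝ => x + τ • e) 0) := by simpa using h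
    exact IsMinFilter.comp_tendsto h' hc
  have := second_deriv_nonneg_of_isLocalMin h4 (h1 0).continuousAt
  rwa [h2, h3.deriv] at this

lemma laplacian_sub {n : ℕ} {f g : EuclideanSpace ℝ (Fin n) → ℝ}
    (hf : ContDiff ℝ 2 f) (hg : ContDiff ℝ 2 g) (x : EuclideanSpace ℝ (Fin n)) :
    laplacian (fun y => f y - g y) x = laplacian f x - laplacian g x := by
  unfold laplacian
  rw [← Finset.sum_sub_distrib]
  refine Finset.sum_congr rfl fun i _ => ?_
  have : (fun y => fderiv ℝ (fun y => f y - g y) y (EuclideanSpace.single i 1)) =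
      fun y => fderiv ℝ f y (EuclideanSpace.single i 1) - fderiv ℝ g y (EuclideanSpace.single i 1) := by
    funext y
    rw [fderiv_fun_sub ((hf.differentiable (by norm_num)) y) ((hg.differentiable (by norm_num)) y)]
    rfl
  rw [this, fderiv_fun_sub (((fderiv_apply_contDiff hf _).differentiable (by norm_num)) x)
    (((fderiv_apply_contDiff hg _).differentiable (by norm_num)) x)]
  rfl

/-- composite of a function of one variable with the squared distance -/
lemma fderiv_comp_normSq {n : ℕ} (x₀ : EuclideanSpace ℝ (Fin n)) {θ θ' : ℝ → ℝ}
    (hθ : ∀ s, HasDerivAt θ (θ' s) s) (x : EuclideanSpace ℝ (Fin n)) (i : Fin n) :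
    fderiv ℝ (fun y => θ (‖y - x₀‖ ^ 2)) x (EuclideanSpace.single i 1) =
      θ' (‖x - x₀‖ ^ 2) * (2 * (x - x₀) i) := by
  have h1 : HasFDerivAt (fun y : EuclideanSpace ℝ (Fin n) => ‖y - x₀‖ ^ 2)
      (2 • (innerSL ℝ (x - x₀)).comp (ContinuousLinearMap.id ℝ _)) x :=
    ((hasFDerivAt_id x).sub_const x₀).norm_sq
  have h2 := (hθ (‖x - x₀‖ ^ 2)).comp_hasFDerivAt x h1
  have h3 : fderiv ℝ (fun y => θ (‖y - x₀‖ ^ 2)) x = _ := h2.fderiv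
  rw [h3]
  simp [EuclideanSpace.inner_single_right]

lemma contDiff_normSq {n : ℕ} (x₀ : EuclideanSpace ℝ (Fin n)) :
    ContDiff ℝ 2 (fun y => ‖y - x₀‖ ^ 2) := by
  exact (contDiff_id.sub contDiff_const).norm_sq ℝ

lemma laplacian_comp_normSq {n : ℕ} (x₀ : EuclideanSpace ℝ (Fin n)) {θ θ' θ'' : ℝ → ℝ}
    (hθ : ∀ s, HasDerivAt θ (θ' s) s) (hθ' : ∀ s, HasDerivAt θ' (θ'' s) s)
    (x : EuclideanSpace ℝ (Fin n)) :
    laplacian (fun y => θ (‖y - x₀‖ ^ 2)) x =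
      4 * θ'' (‖x - x₀‖ ^ 2) * ‖x - x₀‖ ^ 2 + 2 * n * θ' (‖x - x₀‖ ^ 2) := by
  unfold laplacian
  have key : ∀ i : Fin n, fderiv ℝ (fun y => fderiv ℝ (fun y => θ (‖y - x₀‖ ^ 2)) y
      (EuclideanSpace.single i 1)) x (EuclideanSpace.single i 1) =
      4 * θ'' (‖x - x₀‖ ^ 2) * ((x - x₀) i) ^ 2 + 2 * θ' (‖x - x₀‖ ^ 2) := by
    intro i
    simp_rw [fderiv_comp_normSq x₀ hθ]
    have hd : DifferentiableAt ℝ (fun y => θ' (‖y - x₀‖ ^ 2)) x :=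
      DifferentiableAt.comp x (hθ' _).differentiableAt
        ((contDiff_normSq x₀).differentiable (by norm_num) x)
    have hp : HasFDerivAt (fun y : EuclideanSpace ℝ (Fin n) => 2 * (y - x₀) i)
        ((2:ℝ) • (EuclideanSpace.proj i : EuclideanSpace ℝ (Fin n) →L[ℝ] ℝ)) x := by
      have h := (((EuclideanSpace.proj i : EuclideanSpace ℝ (Fin n) →L[ℝ] ℝ).hasFDerivAt (x := x)).sub_const (x₀ i)).const_smul (2:ℝ)
      refine h.congr_of_eventuallyEq (Eventually.of_forall fun y => ?_)
      simp
    rw [fderiv_fun_mul hd hp.differentiableAt, hp.fderiv]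
    have := fderiv_comp_normSq x₀ hθ' x i
    simp only [add_apply, smul_apply, this]
    simp
    ring
  simp_rw [key]
  rw [Finset.sum_add_distrib, ← Finset.mul_sum, EuclideanSpace.norm_sq_eq]
  simp
  ring

/-- Comparison at one point: the maximum principle on a small cylinder. -/
lemma comparison_point {n : ℕ} {u g : EuclideanSpace ℝ (Fin n) → ℝ → ℝ}
    (hu_cont : ContinuousOn (fun q : EuclideanSpace ℝ (Fin n) × ℝ => u q.1 q.2)
      {q : EuclideanSpace ℝ (Fin n) × ℝ | 0 < q.2})
    (hu_space : ∀ t : ℝ, 0 < t → ContDiff ℝ 2 (fun x => u x t))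
    (hu_time : ∀ x, ∀ t : ℝ, 0 < t → HasDerivAt (fun s => u x s)
      (laplacian (fun y => u y t) x + g x t) t)
    {t h r κ c : ℝ} (ht : 0 < t) (hh : 0 < h) (hr : 0 < r) (hκ : 0 < κ)
    (x₁ : EuclideanSpace ℝ (Fin n))
    (hint : ∀ x ∈ Metric.ball x₁ r, ∀ s ∈ Ioc t (t + h),
      c + 2 * n * κ < g x s + laplacian (fun y => u y t) x)
    (hlat : ∀ x ∈ Metric.sphere x₁ r, ∀ s ∈ Icc t (t + h),
      0 ≤ u x s - u x t - (s - t) * c + κ * r ^ 2) :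
    ∀ s ∈ Icc t (t + h), (s - t) * c ≤ u x₁ s - u x₁ t := by
  set w : EuclideanSpace ℝ (Fin n) × ℝ → ℝ := fun q =>
    u q.1 q.2 - u q.1 t - (q.2 - t) * c + κ * ‖q.1 - x₁‖ ^ 2 with hw
  have hcpt : IsCompact (Metric.closedBall x₁ r ×ˢ Icc t (t + h)) :=
    (isCompact_closedBall x₁ r).prod isCompact_Icc
  have hne : (Metric.closedBall x₁ r ×ˢ Icc t (t + h)).Nonempty :=
    ⟨(x₁, t), Metric.mem_closedBall_self hr.le, le_rfl, by linarith⟩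
  have hwc : ContinuousOn w (Metric.closedBall x₁ r ×ˢ Icc t (t + h)) := by
    have h1 : ContinuousOn (fun q : EuclideanSpace ℝ (Fin n) × ℝ => u q.1 q.2)
        (Metric.closedBall x₁ r ×ˢ Icc t (t + h)) :=
      hu_cont.mono fun q hq => lt_of_lt_of_le ht hq.2.1
    have h2 : Continuous (fun q : EuclideanSpace ℝ (Fin n) × ℝ => u q.1 t) :=
      (hu_space t ht).continuous.comp continuous_fst
    exact ((h1.sub h2.continuousOn).sub (by fun_prop)).add (by fun_prop)
  obtain ⟨⟨y, s₁⟩, ⟨hy, hs₁⟩, hmin⟩ := hcpt.exists_isMinOn hne hwc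
  simp only at hy hs₁
  have hmin' : ∀ x ∈ Metric.closedBall x₁ r, ∀ s ∈ Icc t (t + h), w (y, s₁) ≤ w (x, s) :=
    fun x hx s hs => hmin (show (x, s) ∈ _ from ⟨hx, hs⟩)
  have hpos : 0 ≤ w (y, s₁) := by
    by_contra hneg
    push Not at hneg
    have hyb : y ∈ Metric.ball x₁ r := by
      rcases (Metric.mem_closedBall.1 hy).lt_or_eq with h1 | h1
      · exact h1
      · exfalso
        have := hlat y h1 s₁ hs₁
        have h2 : ‖y - x₁‖ = r := by rw [← dist_eq_norm]; exact h1
        simp only [hw, h2] at hneg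
        linarith
    have hst : t < s₁ := by
      rcases hs₁.1.lt_or_eq with h1 | h1
      · exact h1
      · exfalso
        simp only [hw, ← h1] at hneg
        have : 0 ≤ κ * ‖y - x₁‖ ^ 2 := by positivity
        linarith
    have hs0 : 0 < s₁ := ht.trans hst
    -- spatial
    have hcu := hu_space s₁ hs0
    have hcq : ContDiff ℝ 2 (fun x => u x t - (κ * ‖x - x₁‖ ^ 2 - (s₁ - t) * c)) :=
      (hu_space t ht).sub ((contDiff_const.mul (contDiff_normSq x₁)).sub contDiff_const)
    have hlocmin : IsLocalMin (fun x => u x s₁ - (u x t - (κ * ‖x - x₁‖ ^ 2 - (s₁ - t) * c))) y := by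
      filter_upwards [Metric.isOpen_ball.mem_nhds hyb] with x hx
      have := hmin' x (Metric.ball_subset_closedBall hx) s₁ hs₁
      simp only [hw] at this
      linarith
    have hL := laplacian_nonneg_of_isLocalMin (hcu.sub hcq) hlocmin
    rw [laplacian_sub hcu hcq, laplacian_sub (hu_space t ht)
      ((contDiff_const.mul (contDiff_normSq x₁)).sub contDiff_const),
      laplacian_comp_normSq x₁ (θ := fun v => κ * v - (s₁ - t) * c) (θ' := fun _ => κ)
        (θ'' := fun _ => 0) (fun v => by
          have := ((hasDerivAt_id v).const_mul κ).sub_const ((s₁ - t) * c)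
          rw [mul_one] at this
          exact this)
        (fun v => hasDerivAt_const v κ)] at hL
    -- temporal
    have hder : HasDerivAt (fun s => w (y, s))
        (laplacian (fun x => u x s₁) y + g y s₁ - c) s₁ := by
      have h1 := (((hu_time y s₁ hs0).sub_const (u y t)).sub
        (((hasDerivAt_id s₁).sub_const t).mul_const c)).add_const (κ * ‖y - x₁‖ ^ 2)
      simpa [hw] using h1
    have hle : laplacian (fun x => u x s₁) y + g y s₁ - c ≤ 0 := by
      have hd := hder.hasDerivWithinAt (s := Iio s₁)
      rw [hasDerivWithinAt_iff_tendsto_slope' (by simp)] at hd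
      refine le_of_tendsto hd ?_
      filter_upwards [Ioo_mem_nhdsLT hst] with s hs
      rw [slope_def_field]
      refine div_nonpos_of_nonneg_of_nonpos ?_ (by linarith [hs.2])
      have := hmin' y hy s ⟨hs.1.le, hs.2.le.trans hs₁.2⟩
      linarith
    have := hint y hyb s₁ ⟨hst, hs₁.2⟩
    linarith
  intro s hs
  have := hpos.trans (hmin' x₁ (Metric.mem_closedBall_self hr.le) s hs)
  simp [hw] at this
  linarith

/-- Uniform lower Dini estimate for the time difference quotients. -/
lemma dini_uniform {n : ℕ} {u g : EuclideanSpace ℝ (Fin n) → ℝ → ℝ}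
    (hu_cont : ContinuousOn (fun q : EuclideanSpace ℝ (Fin n) × ℝ => u q.1 q.2)
      {q : EuclideanSpace ℝ (Fin n) × ℝ | 0 < q.2})
    (hg_cont : ContinuousOn (fun q : EuclideanSpace ℝ (Fin n) × ℝ => g q.1 q.2)
      {q : EuclideanSpace ℝ (Fin n) × ℝ | 0 < q.2})
    (hu_space : ∀ t : ℝ, 0 < t → ContDiff ℝ 2 (fun x => u x t))
    (hu_time : ∀ x, ∀ t : ℝ, 0 < t → HasDerivAt (fun s => u x s)
      (laplacian (fun y => u y t) x + g x t) t)
    (x₀ : EuclideanSpace ℝ (Fin n)) (R : ℝ) {t η : ℝ} (ht : 0 < t) (hη : 0 < η) :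
    ∀ᶠ s in 𝓝[>] t, ∀ x ∈ Metric.closedBall x₀ R,
      (s - t) * (laplacian (fun y => u y t) x + g x t - η) ≤ u x s - u x t := by
  have hcpt : IsCompact (Metric.closedBall x₀ (R + 1) ×ˢ Icc t (t + 1)) :=
    (isCompact_closedBall x₀ (R + 1)).prod isCompact_Icc
  have hsub : Metric.closedBall x₀ (R + 1) ×ˢ Icc t (t + 1) ⊆
      {q : EuclideanSpace ℝ (Fin n) × ℝ | 0 < q.2} := fun q hq => lt_of_lt_of_le ht hq.2.1
  have hLc := laplacian_continuous (hu_space t ht)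
  have uu := Metric.uniformContinuousOn_iff.1
    (hcpt.uniformContinuousOn_of_continuous (hu_cont.mono hsub))
  have ug := Metric.uniformContinuousOn_iff.1
    (hcpt.uniformContinuousOn_of_continuous (hg_cont.mono hsub))
  have uL := Metric.uniformContinuousOn_iff.1
    ((isCompact_closedBall x₀ (R + 1)).uniformContinuousOn_of_continuous hLc.continuousOn)
  obtain ⟨d1, hd1, h1⟩ := ug (η / 4) (by linarith)
  obtain ⟨d2, hd2, h2⟩ := uL (η / 4) (by linarith)
  have hFc : ContinuousOn (fun x => laplacian (fun y => u y t) x + g x t - η)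
      (Metric.closedBall x₀ (R + 1)) := by
    refine (hLc.continuousOn.add ?_).sub continuousOn_const
    exact hg_cont.comp (f := fun x => (x, t)) (by fun_prop) (fun x _ => ht)
  obtain ⟨M, hM⟩ := (isCompact_closedBall x₀ (R + 1)).exists_bound_of_continuousOn hFc
  set κ : ℝ := η / (8 * (n + 1)) with hκdef
  have hκ : 0 < κ := by positivity
  have hκ2 : 2 * n * κ ≤ η / 4 := by
    rw [hκdef, mul_div_assoc', div_le_div_iff₀ (by positivity) (by norm_num)]
    nlinarith [(Nat.cast_nonneg n : (0:ℝ) ≤ n)]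
  set r : ℝ := min 1 (min d1 d2 / 2) with hrdef
  have hmd : 0 < min d1 d2 := lt_min hd1 hd2
  have hr : 0 < r := lt_min one_pos (by linarith)
  have hr1 : r ≤ 1 := min_le_left _ _
  have hrd : r ≤ min d1 d2 / 2 := min_le_right _ _
  have hrd1 : r < d1 := by linarith [min_le_left d1 d2]
  have hrd2 : r < d2 := by linarith [min_le_right d1 d2]
  obtain ⟨d3, hd3, h3⟩ := uu (κ * r ^ 2 / 2) (by positivity)
  set h : ℝ := min (min 1 (d1 / 2)) (min (d3 / 2) (κ * r ^ 2 / (2 * (|M| + 1)))) with hhdef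
  have hh : 0 < h := by
    refine lt_min (lt_min one_pos (by linarith)) (lt_min (by linarith) (by positivity))
  have hh1 : h ≤ 1 := (min_le_left _ _).trans (min_le_left _ _)
  have hhd1 : h < d1 := lt_of_le_of_lt ((min_le_left _ _).trans (min_le_right _ _)) (by linarith)
  have hhd3 : h < d3 := lt_of_le_of_lt ((min_le_right _ _).trans (min_le_left _ _)) (by linarith)
  have hhM : h * (|M| + 1) ≤ κ * r ^ 2 / 2 := by
    have : h ≤ κ * r ^ 2 / (2 * (|M| + 1)) := (min_le_right _ _).trans (min_le_right _ _)
    rw [le_div_iff₀ (by positivity)] at this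
    linarith
  filter_upwards [Ioo_mem_nhdsGT (show t < t + h by linarith)] with s hs x₁ hx₁
  have hx₁' : x₁ ∈ Metric.closedBall x₀ (R + 1) :=
    Metric.closedBall_subset_closedBall (by linarith) hx₁
  have hball : ∀ x, dist x x₁ ≤ r → x ∈ Metric.closedBall x₀ (R + 1) := by
    intro x hx
    have := dist_triangle x x₁ x₀
    have h5 := Metric.mem_closedBall.1 hx₁
    exact Metric.mem_closedBall.2 (by linarith)
  have htm : t ∈ Icc t (t + 1) := ⟨le_rfl, by linarith⟩
  refine comparison_point hu_cont hu_space hu_time ht hh hr hκ x₁ ?_ ?_ s ⟨hs.1.le, hs.2.le⟩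
  · intro x hx τ hτ
    have hx' := hball x (Metric.mem_ball.1 hx).le
    have e1 := h1 (x, τ) ⟨hx', hτ.1.le, by linarith [hτ.2]⟩ (x₁, t) ⟨hx₁', htm⟩ (by
      rw [Prod.dist_eq]
      refine max_lt ((Metric.mem_ball.1 hx).trans hrd1) ?_
      rw [Real.dist_eq, abs_of_nonneg (by linarith [hτ.1])]
      linarith [hτ.2])
    have e2 := h2 x hx' x₁ hx₁' ((Metric.mem_ball.1 hx).trans hrd2)
    rw [Real.dist_eq, abs_lt] at e1 e2
    simp only at e1
    linarith [e1.1, e2.1]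
  · intro x hx τ hτ
    have hx' := hball x (Metric.mem_sphere.1 hx).le
    have e3 := h3 (x, τ) ⟨hx', hτ.1, by linarith [hτ.2]⟩ (x, t) ⟨hx', htm⟩ (by
      rw [Prod.dist_eq]
      refine max_lt (by simpa using hd3) ?_
      rw [Real.dist_eq, abs_of_nonneg (by linarith [hτ.1])]
      linarith [hτ.2])
    rw [Real.dist_eq, abs_lt] at e3
    simp only at e3
    have e4 := hM x₁ hx₁'
    rw [Real.norm_eq_abs] at e4
    have e5 : (τ - t) * (laplacian (fun y => u y t) x₁ + g x₁ t - η) ≤ h * (|M| + 1) := by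
      refine (mul_le_mul_of_nonneg_left (b := _) (c := |M| + 1) ?_ (by linarith [hτ.1])).trans ?_
      · linarith [le_abs_self (laplacian (fun y => u y t) x₁ + g x₁ t - η), le_abs_self M]
      · exact mul_le_mul_of_nonneg_right (by linarith [hτ.2]) (by positivity)
    linarith [e3.1]

lemma integral_laplacian_mul {n : ℕ} {w f : EuclideanSpace ℝ (Fin n) → ℝ}
    (hw : ContDiff ℝ 2 w) (hf : ContDiff ℝ 2 f) (hfc : HasCompactSupport f) :
    ∫ x, laplacian w x * f x = ∫ x, w x * laplacian f x := by
  have hfi : ∀ e, HasCompactSupport (fun y => fderiv ℝ f y e) := fun e => hfc.fderiv_apply ℝ e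
  have hfii : ∀ e, HasCompactSupport (fun x => fderiv ℝ (fun y => fderiv ℝ f y e) x e) :=
    fun e => (hfi e).fderiv_apply ℝ e
  have c1 : ∀ {k : EuclideanSpace ℝ (Fin n) → ℝ} (e), ContDiff ℝ 2 k →
      Continuous (fun y => fderiv ℝ k y e) := fun e hk => (fderiv_apply_contDiff hk e).continuous
  have c2 : ∀ {k : EuclideanSpace ℝ (Fin n) → ℝ} (e), ContDiff ℝ 2 k →
      Continuous (fun x => fderiv ℝ (fun y => fderiv ℝ k y e) x e) := fun e hk =>
    ((fderiv_apply_contDiff hk _).continuous_fderiv (by norm_num)).clm_apply continuous_const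
  have d1 : ∀ {k : EuclideanSpace ℝ (Fin n) → ℝ}, ContDiff ℝ 2 k → Differentiable ℝ k :=
    fun hk => hk.differentiable (by norm_num)
  have d2 : ∀ {k : EuclideanSpace ℝ (Fin n) → ℝ} (e), ContDiff ℝ 2 k →
      Differentiable ℝ (fun y => fderiv ℝ k y e) :=
    fun e hk => (fderiv_apply_contDiff hk e).differentiable (by norm_num)
  have i1 : ∀ e, Integrable (fun x => fderiv ℝ (fun y => fderiv ℝ w y e) x e * f x) := fun e =>
    ((c2 e hw).mul hf.continuous).integrable_of_hasCompactSupport hfc.mul_left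
  have i2 : ∀ e, Integrable (fun x => fderiv ℝ w x e * fderiv ℝ f x e) := fun e =>
    ((c1 e hw).mul (c1 e hf)).integrable_of_hasCompactSupport (hfi e).mul_left
  have i3 : ∀ e, Integrable (fun x => w x * fderiv ℝ (fun y => fderiv ℝ f y e) x e) := fun e =>
    (hw.continuous.mul (c2 e hf)).integrable_of_hasCompactSupport (hfii e).mul_left
  have i4 : ∀ e, Integrable (fun x => fderiv ℝ w x e * f x) := fun e =>
    ((c1 e hw).mul hf.continuous).integrable_of_hasCompactSupport hfc.mul_left
  have i5 : ∀ e, Integrable (fun x => w x * fderiv ℝ f x e) := fun e =>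
    (hw.continuous.mul (c1 e hf)).integrable_of_hasCompactSupport (hfi e).mul_left
  have key : ∀ e, ∫ x, fderiv ℝ (fun y => fderiv ℝ w y e) x e * f x =
      ∫ x, w x * fderiv ℝ (fun y => fderiv ℝ f y e) x e := by
    intro e
    have a := integral_mul_fderiv_eq_neg_fderiv_mul_of_integrable (μ := volume)
      (f := fun y => fderiv ℝ w y e) (g := f) (v := e) (i1 e) (i2 e) (i4 e)
      (fun x _ => d2 e hw x) (fun x _ => d1 hf x)
    have b := integral_mul_fderiv_eq_neg_fderiv_mul_of_integrable (μ := volume)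
      (f := w) (g := fun y => fderiv ℝ f y e) (v := e) (i2 e) (i3 e) (i5 e)
      (fun x _ => d1 hw x) (fun x _ => d2 e hf x)
    linarith
  unfold laplacian
  simp_rw [Finset.sum_mul, Finset.mul_sum]
  rw [integral_finsetSum _ (fun i _ => i1 _), integral_finsetSum _ (fun i _ => i3 _)]
  exact Finset.sum_congr rfl fun i _ => key _

lemma hasDerivAt_max_pow (k : ℕ) (s : ℝ) :
    HasDerivAt (fun s : ℝ => (max 0 s) ^ (k + 2)) ((k + 2 : ℕ) * (max 0 s) ^ (k + 1)) s := by
  rcases lt_trichotomy s 0 with h | h | h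
  · have e : (fun s : ℝ => (max 0 s) ^ (k + 2)) =ᶠ[𝓝 s] fun _ => 0 := by
      filter_upwards [gt_mem_nhds h] with y hy
      rw [max_eq_left hy.le]; simp
    rw [max_eq_left h.le]
    simpa using (hasDerivAt_const s (0:ℝ)).congr_of_eventuallyEq e
  · subst h
    have h1 : HasDerivWithinAt (fun s : ℝ => (max 0 s) ^ (k + 2)) 0 (Iic 0) 0 :=
      (hasDerivWithinAt_const (0:ℝ) (Iic 0) (0:ℝ)).congr
        (fun y hy => by rw [max_eq_left hy]; simp) (by simp)
    have h2 : HasDerivWithinAt (fun s : ℝ => (max 0 s) ^ (k + 2)) 0 (Ici 0) 0 := by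
      have := ((hasDerivAt_pow (k + 2) (0:ℝ)).hasDerivWithinAt (s := Ici 0)).congr
        (f₁ := fun s : ℝ => (max 0 s) ^ (k + 2))
        (fun y hy => by rw [max_eq_right hy]) (by simp)
      simpa using this
    have := h1.union h2
    rw [Iic_union_Ici, hasDerivWithinAt_univ] at this
    simpa using this
  · have e : (fun s : ℝ => (max 0 s) ^ (k + 2)) =ᶠ[𝓝 s] fun s => s ^ (k + 2) := by
      filter_upwards [lt_mem_nhds h] with y hy
      rw [max_eq_right hy.le]
    rw [max_eq_right h.le]
    exact (hasDerivAt_pow (k + 2) s).congr_of_eventuallyEq e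

/-- Existence of the spatial test function. -/
lemma exists_test {n : ℕ} (x₀ : EuclideanSpace ℝ (Fin n)) {R : ℝ} (hR : 0 < R) :
    ∃ f : EuclideanSpace ℝ (Fin n) → ℝ, ContDiff ℝ 2 f ∧ (∀ x, 0 ≤ f x) ∧ (∀ x, f x ≤ 1) ∧
      (∀ x, x ∉ Metric.ball x₀ R → f x = 0) ∧
      (∀ x ∈ Metric.ball x₀ (R / 2), 27 / 64 ≤ f x) ∧
      (∀ x, 0 ≤ laplacian f x + (3 * ((n:ℝ) + 4) ^ 2 / 8) / R ^ 2 * f x) := by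
  set θ : ℝ → ℝ := fun v => (max 0 (1 - v / R ^ 2)) ^ 3 with hθd
  set θ' : ℝ → ℝ := fun v => 3 * (max 0 (1 - v / R ^ 2)) ^ 2 * (-(1 / R ^ 2)) with hθd'
  set θ'' : ℝ → ℝ := fun v => 6 * (max 0 (1 - v / R ^ 2)) * (1 / R ^ 2) ^ 2 with hθd''
  have hin : ∀ v : ℝ, HasDerivAt (fun v : ℝ => 1 - v / R ^ 2) (-(1 / R ^ 2)) v := fun v =>
    ((hasDerivAt_id v).div_const (R ^ 2)).const_sub 1
  have hθ : ∀ v, HasDerivAt θ (θ' v) v := fun v => by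
    have := (hasDerivAt_max_pow 1 (1 - v / R ^ 2)).comp v (hin v)
    refine this.congr_deriv ?_
    simp only [hθd']
    norm_num
  have hθ' : ∀ v, HasDerivAt θ' (θ'' v) v := fun v => by
    have := (((hasDerivAt_max_pow 0 (1 - v / R ^ 2)).comp v (hin v)).const_mul 3).mul_const
      (-(1 / R ^ 2))
    refine this.congr_deriv ?_
    simp only [hθd'']
    norm_num
    ring
  have hcd : ContDiff ℝ 2 θ := by
    have e1 : deriv θ = θ' := funext fun v => (hθ v).deriv
    have e2 : deriv θ' = θ'' := funext fun v => (hθ' v).deriv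
    have c1 : ContDiff ℝ 1 θ' := by
      rw [contDiff_one_iff_deriv, e2]
      refine ⟨fun v => (hθ' v).differentiableAt, ?_⟩
      simp only [hθd'']
      fun_prop
    rw [show (2 : WithTop ℕ∞) = 1 + 1 by norm_num, contDiff_succ_iff_deriv, e1]
    exact ⟨fun v => (hθ v).differentiableAt, by simp, c1⟩
  have hR2 : 0 < R ^ 2 := by positivity
  have hm0 : ∀ v, 0 ≤ max 0 (1 - v / R ^ 2) := fun v => le_max_left _ _
  refine ⟨fun x => θ (‖x - x₀‖ ^ 2), hcd.comp (contDiff_normSq x₀), fun x => ?_, fun x => ?_,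
    fun x hx => ?_, fun x hx => ?_, fun x => ?_⟩
  · exact pow_nonneg (hm0 _) 3
  · refine pow_le_one₀ (hm0 _) (max_le zero_le_one ?_)
    have : 0 ≤ ‖x - x₀‖ ^ 2 / R ^ 2 := by positivity
    linarith
  · rw [Metric.mem_ball, not_lt, dist_eq_norm] at hx
    have : 1 ≤ ‖x - x₀‖ ^ 2 / R ^ 2 := by
      rw [le_div_iff₀ hR2, one_mul]
      gcongr
    simp only [hθd]
    rw [max_eq_left (by linarith)]
    norm_num
  · rw [Metric.mem_ball, dist_eq_norm] at hx
    have : ‖x - x₀‖ ^ 2 / R ^ 2 ≤ 1 / 4 := by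
      rw [div_le_iff₀ hR2]
      have : ‖x - x₀‖ ^ 2 ≤ (R / 2) ^ 2 := by gcongr
      linarith
    have h34 : (3 / 4 : ℝ) ≤ max 0 (1 - ‖x - x₀‖ ^ 2 / R ^ 2) := le_max_of_le_right (by linarith)
    calc (27 / 64 : ℝ) = (3 / 4) ^ 3 := by norm_num
      _ ≤ _ := by simp only [hθd]; gcongr
  · rw [laplacian_comp_normSq x₀ hθ hθ']
    simp only [hθd, hθd', hθd'']
    set v := ‖x - x₀‖ ^ 2 with hv
    rcases le_total (1 - v / R ^ 2) 0 with h | h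
    · rw [max_eq_left h]; norm_num
    · rw [max_eq_right h]
      set m := 1 - v / R ^ 2 with hm
      have hvm : v = (1 - m) * R ^ 2 := by rw [hm]; field_simp; ring
      rw [hvm]
      have : 4 * (6 * m * (1 / R ^ 2) ^ 2) * ((1 - m) * R ^ 2) +
          2 * ↑n * (3 * m ^ 2 * -(1 / R ^ 2)) + 3 * ((n:ℝ) + 4) ^ 2 / 8 / R ^ 2 * m ^ 3 =
          m / R ^ 2 * (24 * (1 - m) - 6 * n * m + 3 * ((n:ℝ) + 4) ^ 2 / 8 * m ^ 2) := by
        field_simp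
        ring
      rw [this]
      refine mul_nonneg (by positivity) ?_
      nlinarith [sq_nonneg (((n:ℝ) + 4) * m - 8)]

/-- Lower Dini estimate for the spatial averages. -/
lemma dini_average {n : ℕ} {u g : EuclideanSpace ℝ (Fin n) → ℝ → ℝ}
    (hu_cont : ContinuousOn (fun q : EuclideanSpace ℝ (Fin n) × ℝ => u q.1 q.2)
      {q : EuclideanSpace ℝ (Fin n) × ℝ | 0 < q.2})
    (hg_cont : ContinuousOn (fun q : EuclideanSpace ℝ (Fin n) × ℝ => g q.1 q.2)
      {q : EuclideanSpace ℝ (Fin n) × ℝ | 0 < q.2})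
    (hu_space : ∀ t : ℝ, 0 < t → ContDiff ℝ 2 (fun x => u x t))
    (hu_time : ∀ x, ∀ t : ℝ, 0 < t → HasDerivAt (fun s => u x s)
      (laplacian (fun y => u y t) x + g x t) t)
    (x₀ : EuclideanSpace ℝ (Fin n)) (R : ℝ) {f : EuclideanSpace ℝ (Fin n) → ℝ}
    (hf : ContDiff ℝ 2 f) (hf0 : ∀ x, 0 ≤ f x) (hfb : ∀ x, x ∉ Metric.ball x₀ R → f x = 0)
    {t η : ℝ} (ht : 0 < t) (hη : 0 < η) :
    ∀ᶠ s in 𝓝[>] t,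
      (s - t) * ((∫ x, u x t * laplacian f x) + (∫ x, g x t * f x) - η) ≤
        (∫ x, u x s * f x) - ∫ x, u x t * f x := by
  have hfc : HasCompactSupport f :=
    HasCompactSupport.intro (isCompact_closedBall x₀ R)
      fun x hx => hfb x fun h => hx (Metric.ball_subset_closedBall h)
  have hgt : ∀ t : ℝ, 0 < t → Continuous (fun x => g x t) := fun t ht =>
    continuousOn_univ.1 (hg_cont.comp (f := fun x => (x, t)) (by fun_prop) (fun x _ => ht))
  have I : ∀ {k : EuclideanSpace ℝ (Fin n) → ℝ}, Continuous k → Integrable (fun x => k x * f x) :=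
    fun hk => (hk.mul hf.continuous).integrable_of_hasCompactSupport hfc.mul_left
  have If : Integrable f := hf.continuous.integrable_of_hasCompactSupport hfc
  have hF0 : 0 ≤ ∫ x, f x := integral_nonneg hf0
  set η' := η / ((∫ x, f x) + 1) with hη'd
  have hη' : 0 < η' := by positivity
  have hη'2 : η' * (∫ x, f x) ≤ η := by
    rw [hη'd, div_mul_eq_mul_div, div_le_iff₀ (by positivity)]
    nlinarith
  filter_upwards [dini_uniform hu_cont hg_cont hu_space hu_time x₀ R ht hη',
    self_mem_nhdsWithin] with s hs hst
  have hst' : t < s := hst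
  have hs0 : 0 < s := ht.trans hst'
  have hL := laplacian_continuous (hu_space t ht)
  have ibp := integral_laplacian_mul (hu_space t ht) hf hfc
  have e1 : (∫ x, u x s * f x) - ∫ x, u x t * f x = ∫ x, (u x s * f x - u x t * f x) :=
    (integral_sub (I (hu_space s hs0).continuous) (I (hu_space t ht).continuous)).symm
  have e2 : (s - t) * ((∫ x, laplacian (fun y => u y t) x * f x) + (∫ x, g x t * f x)
      - η' * ∫ x, f x) = ∫ x, (s - t) * (laplacian (fun y => u y t) x * f x + g x t * f x
        - η' * f x) := by
    have i12 : Integrable fun x => laplacian (fun y => u y t) x * f x + g x t * f x :=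
      (I hL).add (I (hgt t ht))
    rw [integral_const_mul, integral_sub i12 (If.const_mul η'),
      integral_add (I hL) (I (hgt t ht)), integral_const_mul]
  rw [← ibp]
  calc _ ≤ (s - t) * ((∫ x, laplacian (fun y => u y t) x * f x) + (∫ x, g x t * f x)
      - η' * ∫ x, f x) := by
        refine mul_le_mul_of_nonneg_left ?_ (by linarith)
        linarith
    _ ≤ _ := by
        rw [e1, e2]
        refine integral_mono ?_ ?_ fun x => ?_
        · exact (((I hL).add (I (hgt t ht))).sub (If.const_mul η')).const_mul _
        · exact (I (hu_space s hs0).continuous).sub (I (hu_space t ht).continuous)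
        · by_cases hx : x ∈ Metric.ball x₀ R
          · have := mul_le_mul_of_nonneg_right (hs x (Metric.ball_subset_closedBall hx)) (hf0 x)
            simp only
            linarith
          · simp [hfb x hx]

/-- Integrating a lower Dini estimate. -/
lemma integral_le_of_dini {W D : ℝ → ℝ} {a b : ℝ} (hab : a ≤ b) (hW : ContinuousOn W (Icc a b))
    (hD : ContinuousOn D (Icc a b))
    (h : ∀ t ∈ Ico a b, ∀ η > 0, ∀ᶠ s in 𝓝[>] t, (s - t) * (D t - η) ≤ W s - W t) :
    ∫ t in a..b, D t ≤ W b - W a := by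
  have hDi : IntervalIntegrable D volume a b := by
    apply ContinuousOn.intervalIntegrable
    rwa [uIcc_of_le hab]
  have key := image_le_of_liminf_slope_right_le_deriv_boundary (f := fun t => - W t) (a := a)
    (b := b) hW.neg (B := fun t => - W a - ∫ τ in a..t, D τ) (B' := fun t => - D t)
    (by simp) ?_ ?_ ?_ (right_mem_Icc.2 hab)
  · linarith
  · refine continuousOn_const.sub ?_
    have := intervalIntegral.continuousOn_primitive_interval' hDi (left_mem_uIcc)
    rwa [uIcc_of_le hab] at this
  · intro t ht
    have h1 : HasDerivWithinAt (fun t => ∫ τ in a..t, D τ) (D t) (Ici t) t := by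
      have hsub : Icc a t ⊆ Icc a b := Icc_subset_Icc_right ht.2.le
      refine intervalIntegral.integral_hasDerivWithinAt_right (t := Ioi t) ?_ ?_ ?_
      · apply ContinuousOn.intervalIntegrable
        rw [uIcc_of_le ht.1]
        exact hD.mono hsub
      · refine ⟨Ioo t b, Ioo_mem_nhdsGT ht.2, ?_⟩
        exact (hD.mono fun y hy => ⟨ht.1.trans hy.1.le, hy.2.le⟩).aestronglyMeasurable
          measurableSet_Ioo
      · have := hD t ⟨ht.1, ht.2.le⟩
        refine (this.mono_of_mem_nhdsWithin ?_)
        refine mem_of_superset (Ioo_mem_nhdsGT ht.2) fun y hy => ⟨ht.1.trans hy.1.le, hy.2.le⟩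
    exact h1.const_sub _
  · intro t ht r hr
    refine Eventually.frequently ?_
    filter_upwards [h t ht ((D t + r) / 2) (by linarith), self_mem_nhdsWithin] with s hs hst
    have hst' : 0 < s - t := sub_pos.2 hst
    rw [slope_def_field, div_lt_iff₀ hst']
    nlinarith

lemma dini_mul {Y ψ : ℝ → ℝ} {A ψ' t : ℝ}
    (hY : ∀ η > 0, ∀ᶠ s in 𝓝[>] t, (s - t) * (A - η) ≤ Y s - Y t)
    (hψ : HasDerivAt ψ ψ' t) (hψ0 : ∀ᶠ s in 𝓝[>] t, 0 ≤ ψ s) (hψt : 0 ≤ ψ t) {D : ℝ}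
    (hD : D ≤ ψ t * A + ψ' * Y t) :
    ∀ η > 0, ∀ᶠ s in 𝓝[>] t, (s - t) * (D - η) ≤ ψ s * Y s - ψ t * Y t := by
  intro η hη
  set η1 := η / (2 * (ψ t + 1)) with hη1d
  have hη1 : 0 < η1 := by positivity
  have hη1b : ψ t * η1 ≤ η / 2 := by
    rw [hη1d, mul_div_assoc', div_le_div_iff₀ (by positivity) (by norm_num)]
    nlinarith
  have l1 : Tendsto ψ (𝓝[>] t) (𝓝 (ψ t)) := hψ.continuousAt.continuousWithinAt
  have l2 : Tendsto (slope ψ t) (𝓝[>] t) (𝓝 ψ') :=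
    (hasDerivWithinAt_iff_tendsto_slope' (by simp)).1 (hψ.hasDerivWithinAt (s := Ioi t))
  have l3 : Tendsto (fun s => ψ s * (A - η1) + slope ψ t s * Y t) (𝓝[>] t)
      (𝓝 (ψ t * (A - η1) + ψ' * Y t)) := (l1.mul_const _).add (l2.mul_const _)
  have l4 := l3.eventually (lt_mem_nhds (show D - η < ψ t * (A - η1) + ψ' * Y t by linarith))
  filter_upwards [hY η1 hη1, hψ0, l4, self_mem_nhdsWithin] with s h1 h2 h3 h4
  have hst : 0 < s - t := sub_pos.2 h4
  have e : (s - t) * slope ψ t s = ψ s - ψ t := by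
    rw [slope_def_field]; field_simp
  have h5 := mul_le_mul_of_nonneg_left h1 h2
  have h6 := mul_le_mul_of_nonneg_left h3.le hst.le
  calc _ ≤ (s - t) * (ψ s * (A - η1) + slope ψ t s * Y t) := h6
    _ = ψ s * ((s - t) * (A - η1)) + ((s - t) * slope ψ t s) * Y t := by ring
    _ ≤ ψ s * (Y s - Y t) + (ψ s - ψ t) * Y t := by rw [e]; linarith
    _ = _ := by ring

lemma young_weight {p u V δ : ℝ} (hp : 1 < p) (hu : 0 ≤ u) (hV : 0 < V) (hδ : 0 < δ) :
    u ≤ δ * (u ^ p * V) + δ ^ (-(1 / (p - 1))) * V ^ (-(1 / (p - 1))) := by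
  have hp0 : 0 < p := by linarith
  have hpq : p.HolderConjugate (p / (p - 1)) := Real.HolderConjugate.conjExponent hp
  have hdV : 0 < δ * V := by positivity
  have hp1 : p - 1 ≠ 0 := by linarith
  have hy := Real.young_inequality_of_nonneg (a := (δ * V) ^ (1 / p) * u)
    (b := (δ * V) ^ (-(1 / p))) (by positivity) (by positivity) hpq
  have e1 : (δ * V) ^ (1 / p) * u * (δ * V) ^ (-(1 / p)) = u := by
    rw [mul_right_comm, ← rpow_add hdV]; simp
  have e2 : ((δ * V) ^ (1 / p) * u) ^ p = δ * (u ^ p * V) := by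
    rw [mul_rpow (by positivity) hu, ← rpow_mul hdV.le, one_div_mul_cancel hp0.ne', rpow_one]
    ring
  have e3 : ((δ * V) ^ (-(1 / p))) ^ (p / (p - 1)) =
      δ ^ (-(1 / (p - 1))) * V ^ (-(1 / (p - 1))) := by
    rw [← rpow_mul hdV.le, ← mul_rpow hδ.le hV.le]
    congr 1
    field_simp
  rw [e1, e2, e3] at hy
  refine hy.trans (add_le_add ?_ ?_)
  · exact div_le_self (by positivity) hp.le
  · refine div_le_self (by positivity) ?_
    rw [le_div_iff₀ (by linarith)]; linarith

lemma core_estimate {n : ℕ} {p : ℝ} (hp : 1 < p)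
    {u V : EuclideanSpace ℝ (Fin n) → ℝ → ℝ}
    (hu_cont : ContinuousOn (fun q : EuclideanSpace ℝ (Fin n) × ℝ => u q.1 q.2)
      {q : EuclideanSpace ℝ (Fin n) × ℝ | 0 < q.2})
    (hV_cont : ContinuousOn (fun q : EuclideanSpace ℝ (Fin n) × ℝ => V q.1 q.2)
      {q : EuclideanSpace ℝ (Fin n) × ℝ | 0 < q.2})
    (hu_space : ∀ t : ℝ, 0 < t → ContDiff ℝ 2 (fun x => u x t))
    (hV_pos : ∀ x, ∀ t : ℝ, 0 < t → 0 < V x t)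
    (hu_nonneg : ∀ x, ∀ t : ℝ, 0 < t → 0 ≤ u x t)
    (hu_time : ∀ x, ∀ t : ℝ, 0 < t → HasDerivAt (fun s => u x s)
      (laplacian (fun y => u y t) x + u x t ^ p * V x t) t)
    (x₀ : EuclideanSpace ℝ (Fin n)) (R : ℝ) {f : EuclideanSpace ℝ (Fin n) → ℝ}
    (hf : ContDiff ℝ 2 f) (hf0 : ∀ x, 0 ≤ f x) (hfb : ∀ x, x ∉ Metric.ball x₀ R → f x = 0)
    {μ : ℝ} (hμ : 0 ≤ μ) (hlap : ∀ x, 0 ≤ laplacian f x + μ * f x)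
    {ε T₁ T₂ : ℝ} (hε : 0 < ε) (hεT : ε ≤ T₁) (hT : T₁ < T₂) :
    ContinuousOn (fun t => ∫ x, (u x t ^ p * V x t) * f x) (Ioi 0) ∧
    ContinuousOn (fun t => ∫ x, V x t ^ (-(1 / (p - 1))) * f x) (Ioi 0) ∧
    (T₂ - T₁) ^ (p / (p - 1)) * ∫ t in ε..T₁, ∫ x, (u x t ^ p * V x t) * f x ≤
      exp (μ * T₂) * (p / (p - 1)) ^ (p / (p - 1)) *
        ∫ t in T₁..T₂, ∫ x, V x t ^ (-(1 / (p - 1))) * f x := by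
  have hg_cont : ContinuousOn (fun q : EuclideanSpace ℝ (Fin n) × ℝ =>
      u q.1 q.2 ^ p * V q.1 q.2) {q : EuclideanSpace ℝ (Fin n) × ℝ | 0 < q.2} :=
    (hu_cont.rpow_const fun q _ => Or.inr (by linarith)).mul hV_cont
  have hk_cont : ContinuousOn (fun q : EuclideanSpace ℝ (Fin n) × ℝ =>
      V q.1 q.2 ^ (-(1 / (p - 1)))) {q : EuclideanSpace ℝ (Fin n) × ℝ | 0 < q.2} :=
    hV_cont.rpow_const fun q hq => Or.inl (hV_pos _ _ hq).ne'
  have hfc : HasCompactSupport f :=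
    HasCompactSupport.intro (isCompact_closedBall x₀ R)
      fun x hx => hfb x fun h => hx (Metric.ball_subset_closedBall h)
  have hslice : ∀ {k : EuclideanSpace ℝ (Fin n) → ℝ → ℝ},
      ContinuousOn (fun q : EuclideanSpace ℝ (Fin n) × ℝ => k q.1 q.2)
        {q : EuclideanSpace ℝ (Fin n) × ℝ | 0 < q.2} →
      ∀ t : ℝ, 0 < t → Continuous (fun x => k x t) := fun hk t ht =>
    continuousOn_univ.1 (hk.comp (f := fun x => (x, t)) (by fun_prop) (fun x _ => ht))
  have I : ∀ {k : EuclideanSpace ℝ (Fin n) → ℝ}, Continuous k → Integrable (fun x => k x * f x) :=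
    fun hk => (hk.mul hf.continuous).integrable_of_hasCompactSupport hfc.mul_left
  have hparam : ∀ {k : EuclideanSpace ℝ (Fin n) → ℝ → ℝ},
      ContinuousOn (fun q : EuclideanSpace ℝ (Fin n) × ℝ => k q.1 q.2)
        {q : EuclideanSpace ℝ (Fin n) × ℝ | 0 < q.2} →
      ContinuousOn (fun t => ∫ x, k x t * f x) (Ioi 0) := by
    intro k hk
    refine continuousOn_integral_of_compact_support (f := fun t x => k x t * f x)
      (isCompact_closedBall x₀ R) ?_ ?_
    · refine ContinuousOn.mul ?_ (hf.continuous.comp continuous_snd).continuousOn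
      exact hk.comp (f := fun q : ℝ × EuclideanSpace ℝ (Fin n) => (q.2, q.1)) (by fun_prop)
        (fun q hq => hq.1)
    · intro t x _ hx
      simp [hfb x fun h => hx (Metric.ball_subset_closedBall h)]
  have hYc := hparam hu_cont
  have hGc := hparam (k := fun x t => u x t ^ p * V x t) hg_cont
  have hKc := hparam (k := fun x t => V x t ^ (-(1 / (p - 1)))) hk_cont
  refine ⟨hGc, hKc, ?_⟩
  set q := p / (p - 1) with hq
  set Y : ℝ → ℝ := fun t => ∫ x, u x t * f x with hY
  set G : ℝ → ℝ := fun t => ∫ x, (u x t ^ p * V x t) * f x with hG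
  set K : ℝ → ℝ := fun t => ∫ x, V x t ^ (-(1 / (p - 1))) * f x with hK
  have hp1 : 0 < p - 1 := by linarith
  have hq1 : 1 < q := by rw [hq, lt_div_iff₀ hp1]; linarith
  have hqs : q - 1 = 1 / (p - 1) := by rw [hq]; field_simp; ring
  have hY0 : ∀ t, 0 < t → 0 ≤ Y t := fun t ht =>
    integral_nonneg fun x => mul_nonneg (hu_nonneg x t ht) (hf0 x)
  have hG0 : ∀ t, 0 < t → 0 ≤ G t := fun t ht =>
    integral_nonneg fun x => mul_nonneg (mul_nonneg (rpow_nonneg (hu_nonneg x t ht) _)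
      (hV_pos x t ht).le) (hf0 x)
  have hK0 : ∀ t, 0 < t → 0 ≤ K t := fun t ht =>
    integral_nonneg fun x => mul_nonneg (rpow_nonneg (hV_pos x t ht).le _) (hf0 x)
  have hdini : ∀ t, 0 < t → ∀ η > 0, ∀ᶠ s in 𝓝[>] t,
      (s - t) * (((∫ x, u x t * laplacian f x) + G t) - η) ≤ Y s - Y t := fun t ht η hη =>
    dini_average (g := fun x t => u x t ^ p * V x t) hu_cont hg_cont hu_space hu_time x₀ R hf hf0
      hfb ht hη
  have hlapint : ∀ t, 0 < t → 0 ≤ (∫ x, u x t * laplacian f x) + μ * Y t := by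
    intro t ht
    have hlc : HasCompactSupport (laplacian f) := by
      refine HasCompactSupport.intro hfc (fun x hx => ?_)
      unfold laplacian
      refine Finset.sum_eq_zero fun i _ => ?_
      have := (tsupport_fderiv_apply_subset (𝕜 := ℝ)
        (f := fun y => fderiv ℝ f y (EuclideanSpace.single i 1)) (EuclideanSpace.single i 1)).trans
        (tsupport_fderiv_apply_subset (𝕜 := ℝ) (f := f) (EuclideanSpace.single i 1))
      by_contra hne
      exact hx (this (subset_tsupport _ hne))
    have i1 : Integrable fun x => u x t * laplacian f x :=
      ((hslice hu_cont t ht).mul (laplacian_continuous hf)).integrable_of_hasCompactSupport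
        hlc.mul_left
    have i2 : Integrable fun x => μ * (u x t * f x) := (I (hslice hu_cont t ht)).const_mul μ
    rw [hY]
    simp only
    rw [← integral_const_mul, ← integral_add i1 i2]
    refine integral_nonneg fun x => ?_
    have := mul_nonneg (hu_nonneg x t ht) (hlap x)
    simp only [Pi.zero_apply]
    linarith
  have hT1 : 0 < T₁ := hε.trans_le hεT
  have hT2 : 0 < T₂ := hT1.trans hT
  have hexp : ∀ t, HasDerivAt (fun t => exp (μ * t)) (exp (μ * t) * μ) t := fun t => by
    simpa using ((hasDerivAt_id t).const_mul μ).exp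
  -- first application
  have s1 : ∫ t in ε..T₁, G t ≤ exp (μ * T₁) * Y T₁ := by
    have := integral_le_of_dini (W := fun t => exp (μ * t) * Y t) (D := G) hεT
      ((by fun_prop : Continuous fun t => exp (μ * t)).continuousOn.mul
        (hYc.mono fun t ht => lt_of_lt_of_le hε ht.1))
      (hGc.mono fun t ht => lt_of_lt_of_le hε ht.1) ?_
    · have h0 : 0 ≤ exp (μ * ε) * Y ε := mul_nonneg (exp_pos _).le (hY0 ε hε)
      linarith
    · intro t ht
      have ht0 : 0 < t := hε.trans_le ht.1
      refine dini_mul (ψ := fun t => exp (μ * t)) (hdini t ht0) (hexp t)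
        (Eventually.of_forall fun s => (exp_pos _).le) (exp_pos _).le ?_
      have h1 : 1 ≤ exp (μ * t) := one_le_exp (by positivity)
      have h2 := mul_nonneg (exp_pos (μ * t)).le (hlapint t ht0)
      nlinarith [hG0 t ht0]
  -- second application
  have s2 : (T₂ - T₁) ^ q * (exp (μ * T₁) * Y T₁) ≤ exp (μ * T₂) * q ^ q * ∫ t in T₁..T₂, K t := by
    have := integral_le_of_dini (W := fun t => (exp (μ * t) * (T₂ - t) ^ q) * Y t)
      (D := fun t => - (exp (μ * T₂) * q ^ q) * K t) hT.le ?_ ?_ ?_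
    · rw [intervalIntegral.integral_const_mul] at this
      simp only [sub_self, zero_rpow (show q ≠ 0 by linarith)] at this
      linarith
    · refine ContinuousOn.mul ?_ (hYc.mono fun t ht => lt_of_lt_of_le hT1 ht.1)
      refine ContinuousOn.mul (by fun_prop) ?_
      exact ContinuousOn.rpow_const (by fun_prop) fun _ _ => Or.inr (by linarith)
    · exact continuousOn_const.mul (hKc.mono fun t ht => lt_of_lt_of_le hT1 ht.1)
    · intro t ht
      have ht0 : 0 < t := hT1.trans_le ht.1
      have hd : 0 < T₂ - t := by linarith [ht.2]
      have hder : HasDerivAt (fun t => exp (μ * t) * (T₂ - t) ^ q)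
          (exp (μ * t) * μ * (T₂ - t) ^ q + exp (μ * t) * (-1 * q * (T₂ - t) ^ (q - 1))) t :=
        (hexp t).mul (((hasDerivAt_id t).const_sub T₂).rpow_const (Or.inl hd.ne'))
      refine dini_mul (ψ := fun t => exp (μ * t) * (T₂ - t) ^ q) (hdini t ht0) hder ?_
        (by positivity) ?_
      · filter_upwards [Ioo_mem_nhdsGT ht.2] with s hs
        have : 0 < T₂ - s := by linarith [hs.2]
        positivity
      · -- Young
        set δ := (T₂ - t) / q with hδ
        have hδ0 : 0 < δ := by positivity
        have hyoung : Y t ≤ δ * G t + δ ^ (-(1 / (p - 1))) * K t := by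
          rw [hY, hG, hK]
          simp only
          have iG := I (hslice (k := fun x t => u x t ^ p * V x t) hg_cont t ht0)
          have iK := I (hslice (k := fun x t => V x t ^ (-(1 / (p - 1)))) hk_cont t ht0)
          rw [← integral_const_mul, ← integral_const_mul,
            ← integral_add (iG.const_mul _) (iK.const_mul _)]
          refine integral_mono (I (hslice hu_cont t ht0))
            ((iG.const_mul _).add (iK.const_mul _)) fun x => ?_
          have := mul_le_mul_of_nonneg_right
            (young_weight hp (hu_nonneg x t ht0) (hV_pos x t ht0) hδ0) (hf0 x)
          simp only
          linarith
        have a1 : q * (T₂ - t) ^ (q - 1) * δ = (T₂ - t) ^ q := by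
          rw [hδ, rpow_sub_one hd.ne']
          field_simp
        have a2 : q * (T₂ - t) ^ (q - 1) * δ ^ (-(1 / (p - 1))) = q ^ q := by
          have hq0 : 0 < q := by linarith
          rw [hδ, ← hqs, div_rpow hd.le hq0.le, rpow_neg hd.le, rpow_neg hq0.le,
            rpow_sub_one hq0.ne']
          have : (T₂ - t) ^ (q - 1) ≠ 0 := (rpow_pos_of_pos hd _).ne'
          have : q ^ q ≠ 0 := (rpow_pos_of_pos hq0 _).ne'
          field_simp
        have hy2 : q * (T₂ - t) ^ (q - 1) * Y t ≤ (T₂ - t) ^ q * G t + q ^ q * K t := by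
          have := mul_le_mul_of_nonneg_left hyoung
            (show 0 ≤ q * (T₂ - t) ^ (q - 1) by positivity)
          rw [mul_add, ← mul_assoc, ← mul_assoc, a1, a2] at this
          exact this
        have hy3 := mul_le_mul_of_nonneg_left hy2 (exp_pos (μ * t)).le
        have hl := mul_nonneg (show 0 ≤ exp (μ * t) * (T₂ - t) ^ q by positivity) (hlapint t ht0)
        have he : exp (μ * t) * (q ^ q * K t) ≤ exp (μ * T₂) * (q ^ q * K t) := by
          refine mul_le_mul_of_nonneg_right (exp_le_exp.2 ?_)
            (mul_nonneg (by positivity) (hK0 t ht0))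
          exact mul_le_mul_of_nonneg_left ht.2.le hμ
        linarith
  exact (mul_le_mul_of_nonneg_left s1 (rpow_nonneg (by linarith) _)).trans s2

/-- The key a priori estimate: for a nonnegative classical solution of `u_t = Δu + u^p V`
on `ℝⁿ × (0,∞)` with `V` satisfying (VOL) with point `x₀`, constants `C₀, R₀` and exponent
`α`, setting `q = p/(p−1)`, there is a constant `C > 0` such that for all `R ≥ R₀`,
`∫_{0}^{R²/4} ∫_{B_{R/2}(x₀)} V u^p ≤ C R^{2+α−2q}`. -/
theorem a_priori_estimate_weighted_superlinear_heat
    {n : ℕ} (p α : ℝ) (hp : 1 < p) (hα : 0 < α)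
    (u V : EuclideanSpace ℝ (Fin n) → ℝ → ℝ)
    (x₀ : EuclideanSpace ℝ (Fin n)) (C₀ R₀ : ℝ) (hC₀ : 0 < C₀) (hR₀ : 0 < R₀)
    -- u is continuous up to t = 0
    (hu_cont : ContinuousOn (fun q : EuclideanSpace ℝ (Fin n) × ℝ => u q.1 q.2)
      {q : EuclideanSpace ℝ (Fin n) × ℝ | 0 ≤ q.2})
    -- u is C² in the space variable for every t > 0
    (hu_space : ∀ t : ℝ, 0 < t → ContDiff ℝ 2 (fun x => u x t))
    -- u is C¹ in the time variable on (0,∞)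
    (hu_time : ∀ x, ContDiffOn ℝ 1 (fun s => u x s) (Ioi 0))
    -- V is continuous on ℝⁿ × (0,∞)
    (hV_cont : ContinuousOn (fun q : EuclideanSpace ℝ (Fin n) × ℝ => V q.1 q.2)
      {q : EuclideanSpace ℝ (Fin n) × ℝ | 0 < q.2})
    -- V is positive
    (hV_pos : ∀ x, ∀ t : ℝ, 0 < t → 0 < V x t)
    -- u is nonnegative
    (hu_nonneg : ∀ x, ∀ t : ℝ, 0 ≤ t → 0 ≤ u x t)
    -- u solves u_t = Δu + u^p V on ℝⁿ × (0,∞)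
    (hpde : ∀ x, ∀ t : ℝ, 0 < t →
      deriv (fun s => u x s) t = laplacian (fun y => u y t) x + u x t ^ p * V x t)
    -- the conditions (VOL) with point x₀, constants C₀, R₀ and exponent α
    (hVOL : ∀ R : ℝ, R₀ ≤ R →
      (∫ t in Ioc (R ^ 2 / 4) (R ^ 2), ∫ x in Metric.ball x₀ R,
          V x t ^ (-(1 / (p - 1)))) ≤ C₀ * R ^ (2 + α) ∧
      (∫ t in Ioc (0 : ℝ) (R ^ 2), ∫ x in Metric.ball x₀ R \ Metric.ball x₀ (R / 2),
          V x t ^ (-(1 / (p - 1)))) ≤ C₀ * R ^ (2 + α)) :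
    ∃ C : ℝ, 0 < C ∧ ∀ R : ℝ, R₀ ≤ R →
      (∫ t in Ioc (0 : ℝ) (R ^ 2 / 4), ∫ x in Metric.ball x₀ (R / 2),
          V x t * u x t ^ p) ≤ C * R ^ (2 + α - 2 * (p / (p - 1))) := by
  have hp1 : 0 < p - 1 := by linarith
  set q := p / (p - 1) with hq
  have hq0 : 0 < q := by positivity
  set lam : ℝ := 3 * ((n:ℝ) + 4) ^ 2 / 8 with hlam
  have hlam0 : 0 ≤ lam := by positivity
  have hu_cont' : ContinuousOn (fun q : EuclideanSpace ℝ (Fin n) × ℝ => u q.1 q.2)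
      {q : EuclideanSpace ℝ (Fin n) × ℝ | 0 < q.2} :=
    hu_cont.mono fun z (hz : 0 < z.2) => hz.le
  have hder : ∀ x, ∀ t : ℝ, 0 < t → HasDerivAt (fun s => u x s)
      (laplacian (fun y => u y t) x + u x t ^ p * V x t) t := by
    intro x t ht
    rw [← hpde x t ht]
    exact (((hu_time x).differentiableOn (by norm_num)).differentiableAt
      (Ioi_mem_nhds ht)).hasDerivAt
  refine ⟨64 / 27 * (exp lam * q ^ q * C₀ * (4 / 3) ^ q), by positivity, fun R hR => ?_⟩
  have hR0 : 0 < R := hR₀.trans_le hR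
  have hR2 : 0 < R ^ 2 := by positivity
  obtain ⟨f, hf, hf0, hf1, hfb, hfl, hlap⟩ := exists_test x₀ hR0
  have hμ : 0 ≤ lam / R ^ 2 := by positivity
  have hT : R ^ 2 / 4 < R ^ 2 := by linarith
  have core := fun (ε : ℝ) (hε : 0 < ε) (hεT : ε ≤ R ^ 2 / 4) =>
    core_estimate hp hu_cont' hV_cont hu_space hV_pos (fun x t ht => hu_nonneg x t ht.le) hder x₀ R
      hf hf0 hfb hμ hlap hε hεT hT
  obtain ⟨hGc, hKc, -⟩ := core (R ^ 2 / 4) (by positivity) le_rfl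
  have hfc : HasCompactSupport f :=
    HasCompactSupport.intro (isCompact_closedBall x₀ R)
      fun x hx => hfb x fun h => hx (Metric.ball_subset_closedBall h)
  have I : ∀ {k : EuclideanSpace ℝ (Fin n) → ℝ}, Continuous k → Integrable (fun x => k x * f x) :=
    fun hk => (hk.mul hf.continuous).integrable_of_hasCompactSupport hfc.mul_left
  have hk_cont : ContinuousOn (fun q : EuclideanSpace ℝ (Fin n) × ℝ =>
      V q.1 q.2 ^ (-(1 / (p - 1)))) {q : EuclideanSpace ℝ (Fin n) × ℝ | 0 < q.2} :=
    hV_cont.rpow_const fun q hq => Or.inl (hV_pos _ _ hq).ne'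
  have hg_cont : ContinuousOn (fun q : EuclideanSpace ℝ (Fin n) × ℝ =>
      u q.1 q.2 ^ p * V q.1 q.2) {q : EuclideanSpace ℝ (Fin n) × ℝ | 0 < q.2} :=
    (hu_cont'.rpow_const fun q _ => Or.inr (by linarith)).mul hV_cont
  have hkt : ∀ t : ℝ, 0 < t → Continuous (fun x => V x t ^ (-(1 / (p - 1)))) := fun t ht =>
    continuousOn_univ.1 (hk_cont.comp (f := fun x => (x, t)) (by fun_prop) (fun x _ => ht))
  have hgt : ∀ t : ℝ, 0 < t → Continuous (fun x => u x t ^ p * V x t) := fun t ht =>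
    continuousOn_univ.1 (hg_cont.comp (f := fun x => (x, t)) (by fun_prop) (fun x _ => ht))
  have hballint : ∀ {k : EuclideanSpace ℝ (Fin n) → ℝ} (r : ℝ), Continuous k →
      IntegrableOn k (Metric.ball x₀ r) := fun r hk =>
    (hk.continuousOn.integrableOn_compact (isCompact_closedBall x₀ r)).mono_set
      Metric.ball_subset_closedBall
  -- the volume condition controls the weighted integral of `V^{-1/(p-1)}`
  have hKbound : ∫ t in (R ^ 2 / 4)..(R ^ 2), ∫ x, V x t ^ (-(1 / (p - 1))) * f x ≤
      C₀ * R ^ (2 + α) := by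
    refine le_trans ?_ (hVOL R hR).1
    rw [intervalIntegral.integral_of_le hT.le]
    refine setIntegral_mono_on ?_ ?_ measurableSet_Ioc ?_
    · exact ((hKc.mono fun t (ht : t ∈ Icc (R ^ 2 / 4) (R ^ 2)) =>
        lt_of_lt_of_le (by positivity) ht.1).integrableOn_compact isCompact_Icc).mono_set
        Ioc_subset_Icc_self
    · have hprod : IntegrableOn (fun z : EuclideanSpace ℝ (Fin n) × ℝ =>
          V z.1 z.2 ^ (-(1 / (p - 1)))) (Metric.ball x₀ R ×ˢ Ioc (R ^ 2 / 4) (R ^ 2))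
          (volume.prod volume) := by
        refine IntegrableOn.mono_set (t := Metric.closedBall x₀ R ×ˢ Icc (R ^ 2 / 4) (R ^ 2)) ?_
          (prod_mono Metric.ball_subset_closedBall Ioc_subset_Icc_self)
        refine ContinuousOn.integrableOn_compact
          ((isCompact_closedBall x₀ R).prod isCompact_Icc) ?_
        exact hk_cont.mono fun z hz => lt_of_lt_of_le (by positivity) hz.2.1
      rw [IntegrableOn, ← Measure.prod_restrict] at hprod
      exact hprod.integral_prod_right
    · intro t ht
      have ht0 : 0 < t := lt_trans (by positivity) ht.1
      have hk0 : ∀ x, 0 ≤ V x t ^ (-(1 / (p - 1))) := fun x => rpow_nonneg (hV_pos x t ht0).le _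
      have e : ∫ x, V x t ^ (-(1 / (p - 1))) * f x =
          ∫ x in Metric.ball x₀ R, V x t ^ (-(1 / (p - 1))) * f x :=
        (setIntegral_eq_integral_of_forall_compl_eq_zero fun x hx => by simp [hfb x hx]).symm
      rw [e]
      refine setIntegral_mono_on (I (hkt t ht0)).integrableOn (hballint R (hkt t ht0))
        measurableSet_ball fun x _ => ?_
      exact mul_le_of_le_one_right (hk0 x) (hf1 x)
  set Bd := 64 / 27 * (exp lam * q ^ q * C₀ * (4 / 3) ^ q) * R ^ (2 + α - 2 * q) with hBd
  have hBd0 : 0 ≤ Bd := by positivity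
  have hGbound : ∀ ε : ℝ, 0 < ε → ε ≤ R ^ 2 / 4 →
      64 / 27 * ∫ t in ε..(R ^ 2 / 4), ∫ x, (u x t ^ p * V x t) * f x ≤ Bd := by
    intro ε hε hεT
    have h1 := (core ε hε hεT).2.2
    have h2 : lam / R ^ 2 * R ^ 2 = lam := by field_simp
    rw [h2, ← hq] at h1
    have h3 := h1.trans (mul_le_mul_of_nonneg_left hKbound (by positivity))
    have hR34 : R ^ 2 - R ^ 2 / 4 = 3 / 4 * R ^ 2 := by ring
    rw [hR34, mul_rpow (by norm_num) hR2.le] at h3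
    have h4 : (R ^ 2) ^ q = R ^ (2 * q) := by
      rw [rpow_mul hR0.le]; norm_num
    rw [h4] at h3
    have h5 : ((4:ℝ) / 3) ^ q * (3 / 4) ^ q = 1 := by
      rw [← mul_rpow (by norm_num) (by norm_num)]; norm_num
    have h6 : R ^ (2 + α - 2 * q) * R ^ (2 * q) = R ^ (2 + α) := by
      rw [← rpow_add hR0]; congr 1; ring
    have h34 : 0 < ((3:ℝ) / 4) ^ q * R ^ (2 * q) := by positivity
    have h7 : ∫ t in ε..(R ^ 2 / 4), ∫ x, (u x t ^ p * V x t) * f x ≤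
        exp lam * q ^ q * C₀ * (4 / 3) ^ q * R ^ (2 + α - 2 * q) := by
      refine le_of_mul_le_mul_left (h3.trans (le_of_eq ?_)) h34
      rw [← h6]
      calc _ = exp lam * q ^ q * C₀ * 1 * (R ^ (2 + α - 2 * q) * R ^ (2 * q)) := by ring
        _ = exp lam * q ^ q * C₀ * ((4 / 3) ^ q * (3 / 4) ^ q) *
            (R ^ (2 + α - 2 * q) * R ^ (2 * q)) := by rw [h5]
        _ = _ := by ring
    rw [hBd]
    linarith
  -- pass to the limit in the initial time
  by_cases hint : IntegrableOn (fun t => ∫ x in Metric.ball x₀ (R / 2), V x t * u x t ^ p)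
      (Ioc 0 (R ^ 2 / 4))
  swap
  · rw [integral_undef hint]
    exact hBd0
  have hmain : ∀ ε : ℝ, 0 < ε → ε ≤ R ^ 2 / 4 →
      (∫ t in Ioc ε (R ^ 2 / 4), ∫ x in Metric.ball x₀ (R / 2), V x t * u x t ^ p) ≤ Bd := by
    intro ε hε hεT
    refine le_trans ?_ (hGbound ε hε hεT)
    rw [intervalIntegral.integral_of_le hεT, ← integral_const_mul]
    refine setIntegral_mono_on (hint.mono_set (Ioc_subset_Ioc_left hε.le)) ?_ measurableSet_Ioc ?_
    · refine Integrable.const_mul ?_ _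
      exact ((hGc.mono fun t (ht : t ∈ Icc ε (R ^ 2 / 4)) =>
        lt_of_lt_of_le hε ht.1).integrableOn_compact isCompact_Icc).mono_set
        Ioc_subset_Icc_self
    · intro t ht
      have ht0 : 0 < t := hε.trans ht.1
      have hg0 : ∀ x, 0 ≤ u x t ^ p * V x t := fun x =>
        mul_nonneg (rpow_nonneg (hu_nonneg x t ht0.le) _) (hV_pos x t ht0).le
      rw [← integral_const_mul]
      have hI : Integrable (fun x => 64 / 27 * (u x t ^ p * V x t * f x)) :=
        (I (hgt t ht0)).const_mul _
      refine le_trans ?_ (setIntegral_le_integral (s := Metric.ball x₀ (R / 2)) hI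
        (Eventually.of_forall fun x => ?_))
      · refine setIntegral_mono_on ?_ hI.integrableOn measurableSet_ball fun x hx => ?_
        · simpa only [mul_comm] using hballint (R / 2) (hgt t ht0)
        · have h1 := hfl x hx
          have h2 := mul_le_mul_of_nonneg_left h1 (hg0 x)
          linarith
      · exact mul_nonneg (by norm_num) (mul_nonneg (hg0 x) (hf0 x))
  have hlim : Tendsto (fun ε => ∫ t in Ioc ε (R ^ 2 / 4),
      ∫ x in Metric.ball x₀ (R / 2), V x t * u x t ^ p) (𝓝[>] 0)
      (𝓝 (∫ t in Ioc 0 (R ^ 2 / 4), ∫ x in Metric.ball x₀ (R / 2), V x t * u x t ^ p)) := by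
    have hT0 : (0:ℝ) < R ^ 2 / 4 := by positivity
    have hint' : IntegrableOn (fun t => ∫ x in Metric.ball x₀ (R / 2), V x t * u x t ^ p)
        (uIcc 0 (R ^ 2 / 4)) := by
      rw [uIcc_of_le hT0.le, integrableOn_Icc_iff_integrableOn_Ioc]
      exact hint
    have hc := intervalIntegral.continuousOn_primitive_interval_left hint' 0 left_mem_uIcc
    rw [uIcc_of_le hT0.le] at hc
    have hc2 := hc.tendsto.mono_left (nhdsWithin_mono 0 Ioc_subset_Icc_self)
    rw [nhdsWithin_Ioc_eq_nhdsGT hT0] at hc2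
    rw [intervalIntegral.integral_of_le hT0.le] at hc2
    refine hc2.congr' ?_
    filter_upwards [Ioo_mem_nhdsGT hT0] with ε hε
    exact intervalIntegral.integral_of_le hε.2.le
  refine le_of_tendsto hlim ?_
  filter_upwards [Ioo_mem_nhdsGT (show (0:ℝ) < R ^ 2 / 4 by positivity)] with ε hε
  exact hmain ε hε.1 hε.2.le
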